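/- Let k = (k_1, …, k_d) be an index of depth d ≥ 1 and weight w, let α be the set of distinct cyclic rotations of k and |α| its cardinality, let n ≥ 1, and let p be a prime with p > w. Then the rational number Σ_{k' ∈ α} Σ_{s=0}^{k'_1 − 2} H⋆_{p−1}(k'_1 − s, k'_2, …, k'_d, s+1) − (w/d)·|α| · H⋆_{p−1}(w+1) − Σ_{k' ∈ α} Σ_{l=0}^{n−1} p^l · H⋆_{p−1}(k'_2, …, k'_d, k'_1, l+1) lies in p^n ℤ_{(p)}. (For k' with k'_1 = 1 the inner sum over s is empty.) -/

import Mathlib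

open Finset

/-- Star multiple harmonic sum `H⋆_m(k)` with weak inequalities `m ≥ m₁ ≥ ⋯ ≥ m_d > 0`. -/
noncomputable def Hstar : ℕ → List ℕ → ℚ
  | _, [] => 1
  | m, k :: ks => ∑ i ∈ Finset.Icc 1 m, (1 / (i : ℚ) ^ k) * Hstar i ks

/-- The set of distinct cyclic rotations of an index. -/
def cycOrbit (k : List ℕ) : Finset (List ℕ) :=
  (Finset.range k.length).image (fun j => k.rotate j)

/-- Iterated star sum with a terminal weight `f`. -/
noncomputable def WS : List ℕ → (ℕ → ℚ) → ℕ → ℚ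
  | [], f, m => f m
  | k :: ks, f, m => ∑ i ∈ Finset.Icc 1 m, (1 / (i : ℚ) ^ k) * WS ks f i

lemma WS_add (ks : List ℕ) (f g : ℕ → ℚ) (m : ℕ) :
    WS ks (fun x => f x + g x) m = WS ks f m + WS ks g m := by
  induction ks generalizing m with
  | nil => rfl
  | cons k ks ih => simp only [WS, ih, mul_add, Finset.sum_add_distrib]

lemma WS_mul (ks : List ℕ) (c : ℚ) (f : ℕ → ℚ) (m : ℕ) :
    WS ks (fun x => c * f x) m = c * WS ks f m := by
  induction ks generalizing m with
  | nil => rfl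
  | cons k ks ih =>
    simp only [WS, ih, Finset.mul_sum]
    exact Finset.sum_congr rfl fun _ _ => by ring

lemma WS_zero (ks : List ℕ) (m : ℕ) : WS ks (fun _ => 0) m = 0 := by
  have := WS_mul ks 0 (fun _ => 0) m
  simpa using this

lemma WS_sum {ι : Type} (s : Finset ι) (ks : List ℕ) (f : ι → ℕ → ℚ) (m : ℕ) :
    WS ks (fun x => ∑ j ∈ s, f j x) m = ∑ j ∈ s, WS ks (f j) m := by
  classical
  induction s using Finset.induction_on with
  | empty => simpa using WS_zero ks m
  | insert a s ha ih => simp only [Finset.sum_insert ha, WS_add, ih]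

lemma WS_congr (ks : List ℕ) (f g : ℕ → ℚ) (m : ℕ) (hm : 1 ≤ m)
    (h : ∀ x, 1 ≤ x → x ≤ m → f x = g x) : WS ks f m = WS ks g m := by
  induction ks generalizing m with
  | nil => exact h m hm le_rfl
  | cons k ks ih =>
    refine Finset.sum_congr rfl fun i hi => ?_
    rw [Finset.mem_Icc] at hi
    rw [ih i hi.1 fun x h1 h2 => h x h1 (h2.trans hi.2)]

lemma WS_append (ks ls : List ℕ) (f : ℕ → ℚ) (m : ℕ) :
    WS (ks ++ ls) f m = WS ks (WS ls f) m := by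
  induction ks generalizing m with
  | nil => rfl
  | cons k ks ih => simp only [List.cons_append, WS, ih]

lemma Hstar_eq (ks : List ℕ) (m : ℕ) : Hstar m ks = WS ks (fun _ => 1) m := by
  induction ks generalizing m with
  | nil => simp [Hstar, WS]
  | cons k ks ih => simp only [Hstar, WS, ih]

lemma WS_diag (ks : List ℕ) (M m : ℕ) (hm : 1 ≤ m) (hM : m ≤ M) (c : ℚ) :
    WS ks (fun x => if M = x then c else 0) m =
      if M = m then c / (M : ℚ) ^ ks.sum else 0 := by
  induction ks generalizing m with
  | nil => simp [WS]
  | cons k ks ih =>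
    have : ∀ i ∈ Finset.Icc 1 m, (1 / (i : ℚ) ^ k) *
        WS ks (fun x => if M = x then c else 0) i =
        if M = i then c / (M : ℚ) ^ (k + ks.sum) else 0 := by
      intro i hi
      rw [Finset.mem_Icc] at hi
      rw [ih i hi.1 (hi.2.trans hM)]
      split_ifs with h
      · subst h; rw [pow_add]; field_simp
      · simp
    simp only [WS, List.sum_cons]
    rw [Finset.sum_congr rfl this, Finset.sum_ite_eq]
    have : M ∈ Finset.Icc 1 m ↔ M = m := by rw [Finset.mem_Icc]; omega
    simp only [this]

lemma tele (x : ℚ) (m : ℕ) :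
    ∑ i ∈ Finset.Icc 1 m, (1 / (x - i) - 1 / (x + 1 - i)) = 1 / (x - m) - 1 / x := by
  induction m with
  | zero => simp
  | succ m ih =>
    rw [Finset.sum_Icc_succ_top (by omega), ih]
    have : x + 1 - ((m + 1 : ℕ) : ℚ) = x - m := by push_cast; ring
    rw [this]; ring

/-- The difference kernel. -/
noncomputable def DD (a b : ℕ) : ℚ := 1 / ((a : ℚ) - b) - 1 / a + if a = b then 1 / (a : ℚ) else 0

lemma DD_sum (m' m N : ℕ) (h : m' ≤ m) (hN : m ≤ N) :
    ∑ i ∈ Finset.Icc m N, DD i m' =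
      (∑ j ∈ Finset.Icc 1 m', 1 / ((m : ℚ) - j)) +
      (∑ j ∈ Finset.Icc 1 m', 1 / ((j : ℚ) - (N + 1))) +
      if m = m' then 1 / (m : ℚ) else 0 := by
  induction N, hN using Nat.le_induction with
  | base =>
    rw [Finset.Icc_self, Finset.sum_singleton, DD, ← tele, ← Finset.sum_add_distrib]
    congr 1
    refine Finset.sum_congr rfl fun j _ => ?_
    rw [← neg_sub ((m : ℚ) + 1) j, one_div_neg_eq_neg_one_div]; ring
  | succ N hN ih =>
    rw [Finset.sum_Icc_succ_top (by omega), ih, DD, if_neg (by omega : ¬ N + 1 = m'), ← tele]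
    have : ∑ j ∈ Finset.Icc 1 m', 1 / ((j : ℚ) - (((N + 1 : ℕ) : ℚ) + 1)) =
        ∑ j ∈ Finset.Icc 1 m', 1 / ((j : ℚ) - (N + 1)) +
        ∑ i ∈ Finset.Icc 1 m', (1 / (((N + 1 : ℕ) : ℚ) - i) - 1 / (((N + 1 : ℕ) : ℚ) + 1 - i)) := by
      rw [← Finset.sum_add_distrib]
      refine Finset.sum_congr rfl fun j _ => ?_
      rw [← neg_sub (((N + 1 : ℕ) : ℚ) + 1) j, one_div_neg_eq_neg_one_div,
        ← neg_sub ((N : ℚ) + 1) j, one_div_neg_eq_neg_one_div]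
      push_cast; ring
    rw [this]; ring

lemma pf (a b k : ℕ) (ha : 1 ≤ a) (hb : 1 ≤ b) (hk : 1 ≤ k) :
    1 / (a : ℚ) ^ k * (1 / ((a : ℚ) - b)) =
      1 / (b : ℚ) ^ k * DD a b -
        (∑ s ∈ Finset.range (k - 1), 1 / (a : ℚ) ^ (k - s) * (1 / (b : ℚ) ^ (s + 1))) +
        if a = b then ((k : ℚ) - 1) / (a : ℚ) ^ (k + 1) else 0 := by
  have ha0 : (a : ℚ) ≠ 0 := by positivity
  have hb0 : (b : ℚ) ≠ 0 := by positivity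
  unfold DD
  by_cases hab : a = b
  · subst hab
    have : ∀ s ∈ Finset.range (k - 1), 1 / (a : ℚ) ^ (k - s) * (1 / (a : ℚ) ^ (s + 1)) =
        1 / (a : ℚ) ^ (k + 1) := by
      intro s hs
      rw [Finset.mem_range] at hs
      rw [one_div_mul_one_div, ← pow_add]
      congr 2; omega
    rw [Finset.sum_congr rfl this]
    simp [Nat.cast_sub hk]
    ring
  · have hd : (a : ℚ) - b ≠ 0 := sub_ne_zero.mpr (by exact_mod_cast hab)
    rw [if_neg hab, if_neg hab]
    induction k, hk using Nat.le_induction with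
    | base => simp; field_simp; ring
    | succ k hk ih =>
      obtain ⟨r, rfl⟩ : ∃ r, k = r + 1 := ⟨k - 1, by omega⟩
      have e : ∑ s ∈ Finset.range (r + 1 + 1 - 1),
          1 / (a : ℚ) ^ (r + 1 + 1 - s) * (1 / (b : ℚ) ^ (s + 1)) =
          1 / a * (∑ s ∈ Finset.range (r + 1 - 1),
            1 / (a : ℚ) ^ (r + 1 - s) * (1 / (b : ℚ) ^ (s + 1))) +
          1 / (a : ℚ) ^ 2 * (1 / (b : ℚ) ^ (r + 1)) := by
        simp only [Nat.add_sub_cancel]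
        rw [Finset.sum_range_succ, Finset.mul_sum]
        congr 1
        · refine Finset.sum_congr rfl fun s hs => ?_
          rw [Finset.mem_range] at hs
          rw [show r + 1 + 1 - s = (r + 1 - s) + 1 by omega, pow_succ]
          field_simp
        · rw [show r + 1 + 1 - r = 2 by omega]
      rw [e]
      have : 1 / (a : ℚ) ^ (r + 1 + 1) * (1 / ((a : ℚ) - b)) =
        1 / a * (1 / (a : ℚ) ^ (r + 1) * (1 / ((a : ℚ) - b))) := by
        rw [pow_succ _ (r + 1)]; field_simp
      rw [this, ih]
      have : 1 / (a : ℚ) * (1 / (b : ℚ) ^ (r + 1) * (1 / ((a : ℚ) - b) - 1 / a + 0)) +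
          1 / (a : ℚ) ^ 2 * (1 / (b : ℚ) ^ (r + 1)) =
          1 / (b : ℚ) ^ (r + 1 + 1) * (1 / ((a : ℚ) - b) - 1 / a + 0) := by
        rw [pow_succ _ (r + 1)]; field_simp; ring
      rw [← this]; ring

/-- The auxiliary Ohno–Wakabayashi type sum. -/
noncomputable def FF (N : ℕ) (k : List ℕ) : ℚ :=
  ∑ a ∈ Finset.Icc 1 N, 1 / (a : ℚ) ^ k.headI *
    WS k.tail (fun m => ∑ b ∈ Finset.Icc 1 m, 1 / ((a : ℚ) - b)) a

/-- The boundary sum. -/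
noncomputable def TT (N : ℕ) (k : List ℕ) : ℚ :=
  WS k (fun m => ∑ b ∈ Finset.Icc 1 m, 1 / ((b : ℚ) - (N + 1))) N

lemma Hstar_single (N k : ℕ) : Hstar N [k] = ∑ a ∈ Finset.Icc 1 N, 1 / (a : ℚ) ^ k := by
  simp [Hstar]

lemma second_step (N b : ℕ) (u : List ℕ) :
    ∑ a ∈ Finset.Icc 1 N, WS (b :: u) (fun m => DD a m) a =
      FF N (b :: u) + TT N (b :: u) + Hstar N [(b :: u).sum + 1] := by
  have h1 : ∑ a ∈ Finset.Icc 1 N, WS (b :: u) (fun m => DD a m) a =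
      ∑ m ∈ Finset.Icc 1 N, 1 / (m : ℚ) ^ b *
        WS u (fun m' => ∑ a ∈ Finset.Icc m N, DD a m') m := by
    simp only [WS, WS_sum, Finset.mul_sum]
    apply Finset.sum_comm'
    intro x y
    simp only [Finset.mem_Icc]; omega
  rw [h1, FF, TT, Hstar_single, WS, ← Finset.sum_add_distrib, ← Finset.sum_add_distrib]
  refine Finset.sum_congr rfl fun m hm => ?_
  rw [Finset.mem_Icc] at hm
  rw [WS_congr u _ _ m hm.1 fun x _ h2 => DD_sum x m N h2 hm.2]
  rw [WS_add, WS_add, WS_diag u m m hm.1 le_rfl, if_pos rfl]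
  simp only [List.headI, List.tail, List.sum_cons]
  have : (m : ℚ) ≠ 0 := by have := hm.1; positivity
  rw [pow_succ, pow_add]
  field_simp

lemma key (N k : ℕ) (hk : 1 ≤ k) (t : List ℕ) :
    ∑ s ∈ Finset.range (k - 1), Hstar N ((k - s) :: (t ++ [s + 1])) =
      FF N (t ++ [k]) - FF N (k :: t) + TT N (t ++ [k]) + k * Hstar N [(k :: t).sum + 1] := by
  have h2 : ∑ a ∈ Finset.Icc 1 N, WS (t ++ [k]) (fun m => DD a m) a =
      FF N (t ++ [k]) + TT N (t ++ [k]) + Hstar N [(k :: t).sum + 1] := by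
    obtain ⟨b, u, hbu⟩ : ∃ b u, t ++ [k] = b :: u := by cases t <;> simp
    have hs : (k :: t).sum = (b :: u).sum := by rw [← hbu]; simp [add_comm]
    rw [hbu, hs, second_step]
  have h3 : FF N (k :: t) = ∑ a ∈ Finset.Icc 1 N, WS (t ++ [k]) (fun m => DD a m) a -
      ∑ s ∈ Finset.range (k - 1), Hstar N ((k - s) :: (t ++ [s + 1])) +
      ((k : ℚ) - 1) * Hstar N [(k :: t).sum + 1] := by
    have e2 : ∑ s ∈ Finset.range (k - 1), Hstar N ((k - s) :: (t ++ [s + 1])) =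
        ∑ a ∈ Finset.Icc 1 N, ∑ s ∈ Finset.range (k - 1), 1 / (a : ℚ) ^ (k - s) *
          WS t (fun m => ∑ b ∈ Finset.Icc 1 m, 1 / (b : ℚ) ^ (s + 1)) a := by
      rw [Finset.sum_comm]
      refine Finset.sum_congr rfl fun s _ => ?_
      rw [Hstar_eq, WS]
      refine Finset.sum_congr rfl fun a _ => ?_
      rw [WS_append]
      congr 2
      funext m
      simp [WS]
    rw [e2, FF, Hstar_single, Finset.mul_sum, ← Finset.sum_sub_distrib, ← Finset.sum_add_distrib]
    refine Finset.sum_congr rfl fun a ha => ?_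
    rw [Finset.mem_Icc] at ha
    simp only [List.headI, List.tail]
    have ha0 : (a : ℚ) ≠ 0 := by have := ha.1; positivity
    have e3 : ((k : ℚ) - 1) * (1 / (a : ℚ) ^ ((k :: t).sum + 1)) =
        WS t (fun m => if a = m then ((k : ℚ) - 1) / (a : ℚ) ^ (k + 1) else 0) a := by
      rw [WS_diag t a a ha.1 le_rfl, if_pos rfl, List.sum_cons, pow_succ, pow_add, pow_succ]
      field_simp
    rw [e3, WS_append, ← WS_mul]
    simp only [← WS_mul]
    rw [← WS_sum, sub_eq_add_neg, ← neg_one_mul, ← WS_mul, ← WS_add, ← WS_add]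
    refine WS_congr _ _ _ _ ha.1 fun x hx1 hx2 => ?_
    have e4 : (if a = x then ((k : ℚ) - 1) / (a : ℚ) ^ (k + 1) else 0) =
        ∑ b ∈ Finset.Icc 1 x, if a = b then ((k : ℚ) - 1) / (a : ℚ) ^ (k + 1) else 0 := by
      rw [Finset.sum_ite_eq]
      have : a ∈ Finset.Icc 1 x ↔ a = x := by rw [Finset.mem_Icc]; omega
      simp only [this]
    rw [e4]
    simp only [WS, Finset.mul_sum]
    rw [Finset.sum_comm, ← Finset.sum_add_distrib, ← Finset.sum_add_distrib]
    refine Finset.sum_congr rfl fun b hb => ?_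
    rw [Finset.mem_Icc] at hb
    rw [pf a b k ha.1 hb.1 hk, ← Finset.mul_sum]
    ring
  rw [h2] at h3
  linarith

lemma mem_cyc {k l : List ℕ} (hne : k ≠ []) : l ∈ cycOrbit k ↔ ∃ j, k.rotate j = l := by
  simp only [cycOrbit, Finset.mem_image, Finset.mem_range]
  constructor
  · rintro ⟨j, _, h⟩; exact ⟨j, h⟩
  · rintro ⟨j, h⟩
    exact ⟨j % k.length, Nat.mod_lt _ (List.length_pos_iff.mpr hne), by rw [List.rotate_mod, h]⟩

lemma cyc_sum_rotate {k : List ℕ} (hne : k ≠ []) (j : ℕ) (f : List ℕ → ℚ) :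
    ∑ l ∈ cycOrbit k, f (l.rotate j) = ∑ l ∈ cycOrbit k, f l := by
  have hinj : Function.Injective (fun l : List ℕ => l.rotate j) := List.rotate_injective j
  have him : (cycOrbit k).image (fun l => l.rotate j) = cycOrbit k := by
    apply Finset.eq_of_subset_of_card_le
    · intro l hl
      rw [Finset.mem_image] at hl
      obtain ⟨l', hl', rfl⟩ := hl
      rw [mem_cyc hne] at hl' ⊢
      obtain ⟨i, rfl⟩ := hl'
      exact ⟨i + j, by rw [List.rotate_rotate]⟩
    · rw [Finset.card_image_of_injective _ hinj]
  conv_rhs => rw [← him]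
  rw [Finset.sum_image fun _ _ _ _ h => hinj h]

lemma headI_rotate (l : List ℕ) (j : ℕ) (h : j < l.length) : (l.rotate j).headI = l[j] := by
  rw [List.rotate_eq_drop_append_take h.le, List.drop_eq_getElem_cons h]
  rfl

lemma cyc_head {k : List ℕ} (hne : k ≠ []) :
    ∑ l ∈ cycOrbit k, (l.headI : ℚ) = (k.sum : ℚ) / k.length * (cycOrbit k).card := by
  have hl : (k.length : ℚ) ≠ 0 := by
    exact_mod_cast (List.length_pos_iff.mpr hne).ne'
  have h1 : ∑ j ∈ Finset.range k.length, ∑ l ∈ cycOrbit k, ((l.rotate j).headI : ℚ) =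
      k.length * ∑ l ∈ cycOrbit k, (l.headI : ℚ) := by
    rw [Finset.sum_congr rfl fun j _ => cyc_sum_rotate hne j fun l => (l.headI : ℚ)]
    simp
  have h2 : ∑ j ∈ Finset.range k.length, ∑ l ∈ cycOrbit k, ((l.rotate j).headI : ℚ) =
      (cycOrbit k).card * k.sum := by
    rw [Finset.sum_comm, ← nsmul_eq_mul]
    apply Finset.sum_eq_card_nsmul
    intro l hl
    obtain ⟨i, hi⟩ := (mem_cyc hne).1 hl
    have hlen : k.length = l.length := by rw [← hi]; simp
    have hsum : k.sum = l.sum := by rw [← hi]; exact (List.rotate_perm k i).sum_eq.symm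
    rw [hlen, hsum, Finset.sum_range, ← Nat.cast_sum, ← Fin.sum_univ_getElem]
    congr 1
    exact Finset.sum_congr rfl fun j _ => headI_rotate l j j.2
  rw [h1] at h2
  field_simp
  linarith

lemma orbit_identity (N : ℕ) (k : List ℕ) (hk : ∀ x ∈ k, 1 ≤ x) (hne : k ≠ []) :
    (∑ k' ∈ cycOrbit k, ∑ s ∈ Finset.range (k'.headI - 1),
          Hstar N ((k'.headI - s) :: (k'.tail ++ [s + 1]))) =
      ((k.sum : ℚ) / (k.length : ℚ)) * ((cycOrbit k).card : ℚ) * Hstar N [k.sum + 1] +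
      ∑ k' ∈ cycOrbit k, TT N (k'.tail ++ [k'.headI]) := by
  have h : ∀ k' ∈ cycOrbit k, ∑ s ∈ Finset.range (k'.headI - 1),
          Hstar N ((k'.headI - s) :: (k'.tail ++ [s + 1])) =
      FF N (k'.rotate 1) - FF N k' + TT N (k'.tail ++ [k'.headI]) +
        k'.headI * Hstar N [k.sum + 1] := by
    intro l hl
    obtain ⟨i, hi⟩ := (mem_cyc hne).1 hl
    have hsum : k.sum = l.sum := by rw [← hi]; exact (List.rotate_perm k i).sum_eq.symm
    have hmem : ∀ x ∈ l, 1 ≤ x := by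
      intro x hx; rw [← hi, List.mem_rotate] at hx; exact hk x hx
    rw [hsum]
    cases l with
    | nil => simp at hi; exact absurd hi hne
    | cons a t =>
      have := key N a (hmem a (by simp)) t
      simpa using this
  rw [Finset.sum_congr rfl h, Finset.sum_add_distrib, Finset.sum_add_distrib,
    Finset.sum_sub_distrib, cyc_sum_rotate hne 1 (FF N), ← Finset.sum_mul, cyc_head hne]
  ring

/-- Membership in `ℤ_{(p)}`. -/
def PInt (p : ℕ) (x : ℚ) : Prop := ∃ a b : ℤ, ¬ ((p : ℤ) ∣ b) ∧ x * b = a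

lemma PInt.mul {p : ℕ} (hp : p.Prime) {x y : ℚ} (hx : PInt p x) (hy : PInt p y) :
    PInt p (x * y) := by
  obtain ⟨a, b, hb, h⟩ := hx
  obtain ⟨c, d, hd, h'⟩ := hy
  refine ⟨a * c, b * d, fun hh => ?_, ?_⟩
  · exact ((Nat.prime_iff_prime_int.1 hp).dvd_or_dvd hh).elim hb hd
  · push_cast; rw [← h, ← h']; ring

lemma PInt.add {p : ℕ} (hp : p.Prime) {x y : ℚ} (hx : PInt p x) (hy : PInt p y) :
    PInt p (x + y) := by
  obtain ⟨a, b, hb, h⟩ := hx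
  obtain ⟨c, d, hd, h'⟩ := hy
  refine ⟨a * d + c * b, b * d, fun hh => ?_, ?_⟩
  · exact ((Nat.prime_iff_prime_int.1 hp).dvd_or_dvd hh).elim hb hd
  · push_cast; rw [← h, ← h']; ring

lemma PInt.sum {p : ℕ} (hp : p.Prime) {ι : Type} (s : Finset ι) (f : ι → ℚ)
    (h : ∀ i ∈ s, PInt p (f i)) : PInt p (∑ i ∈ s, f i) := by
  refine Finset.sum_induction f (PInt p) (fun _ _ => PInt.add hp) ?_ h
  exact ⟨0, 1, fun hh => (Nat.prime_iff_prime_int.1 hp).not_isUnit (isUnit_of_dvd_one hh), by simp⟩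

lemma PInt.inv {p : ℕ} (b : ℤ) (hb : ¬ ((p : ℤ) ∣ b)) : PInt p (1 / (b : ℚ)) := by
  refine ⟨1, b, hb, ?_⟩
  have : (b : ℚ) ≠ 0 := by
    intro h
    have : b = 0 := by exact_mod_cast h
    subst this; simp at hb
  field_simp
  simp

lemma PInt.WS {p : ℕ} (hp : p.Prime) (ks : List ℕ) (f : ℕ → ℚ) (m : ℕ) (hm : 1 ≤ m) (hmp : m < p)
    (h : ∀ x, 1 ≤ x → x < p → PInt p (f x)) : PInt p (WS ks f m) := by
  induction ks generalizing m with
  | nil => exact h m hm hmp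
  | cons k ks ih =>
    refine PInt.sum hp _ _ fun i hi => ?_
    rw [Finset.mem_Icc] at hi
    refine PInt.mul hp ?_ (ih i hi.1 (by omega))
    have := PInt.inv (p := p) ((i : ℤ) ^ k) (fun hh => by
      have := (Nat.prime_iff_prime_int.1 hp).dvd_of_dvd_pow hh
      have := Nat.le_of_dvd (by omega) (Int.natCast_dvd_natCast.1 this)
      omega)
    simpa using this

lemma geom (p m : ℚ) (hm : m ≠ 0) (h : m - p ≠ 0) (n : ℕ) :
    ∑ l ∈ Finset.range n, p ^ l * (1 / m ^ (l + 1)) =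
      1 / (m - p) + (- p ^ n) * (1 / (m ^ n * (m - p))) := by
  induction n with
  | zero => simp
  | succ n ih =>
    rw [Finset.sum_range_succ, ih]
    field_simp
    ring

lemma tail_sum (n p : ℕ) (hp : p.Prime) (ks : List ℕ) :
    ∑ l ∈ Finset.range n, (p : ℚ) ^ l * Hstar (p - 1) (ks ++ [l + 1]) =
      TT (p - 1) ks + (- (p : ℚ) ^ n) *
        WS ks (fun m => ∑ b ∈ Finset.Icc 1 m, 1 / ((b : ℚ) ^ n * ((b : ℚ) - p))) (p - 1) := by
  have hp2 := hp.two_le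
  simp only [Hstar_eq, WS_append, TT, ← WS_mul]
  rw [← WS_sum, ← WS_add]
  refine WS_congr _ _ _ _ (by omega) fun x hx1 hx2 => ?_
  simp only [WS, mul_one, Finset.mul_sum]
  rw [Finset.sum_comm, ← Finset.sum_add_distrib]
  refine Finset.sum_congr rfl fun b hb => ?_
  rw [Finset.mem_Icc] at hb
  have e : ((p - 1 : ℕ) : ℚ) + 1 = p := by
    rw [Nat.cast_sub (by omega)]; simp
  rw [e]
  simp only [mul_comm _ ((p : ℚ) ^ _)]
  refine (geom (p : ℚ) b ?_ ?_ n).trans (by ring)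
  · have := hb.1; positivity
  · rw [sub_ne_zero]; norm_cast; omega

/-- Cyclic sum formula for `𝒜̂`-MZSVs (Corollary 5.10 of the paper, star version):
the displayed rational number lies in `p^n ℤ_{(p)}`. -/
theorem stmt9 (k : List ℕ) (hk : ∀ x ∈ k, 1 ≤ x) (hne : k ≠ [])
    (n : ℕ) (hn : 1 ≤ n) (p : ℕ) (hp : p.Prime) (hpw : k.sum < p) :
    ∃ a b : ℤ, ¬ ((p : ℤ) ∣ b) ∧
      ((∑ k' ∈ cycOrbit k, ∑ s ∈ Finset.range (k'.headI - 1),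
          Hstar (p - 1) ((k'.headI - s) :: (k'.tail ++ [s + 1]))) -
        ((k.sum : ℚ) / (k.length : ℚ)) * ((cycOrbit k).card : ℚ) * Hstar (p - 1) [k.sum + 1] -
        ∑ k' ∈ cycOrbit k, ∑ l ∈ Finset.range n, (p : ℚ) ^ l *
          Hstar (p - 1) (k'.tail ++ [k'.headI, l + 1])) * b = p ^ n * a := by
  have hp2 := hp.two_le
  have hR : PInt p (∑ k' ∈ cycOrbit k, WS (k'.tail ++ [k'.headI])
      (fun m => ∑ b ∈ Finset.Icc 1 m, 1 / ((b : ℚ) ^ n * ((b : ℚ) - p))) (p - 1)) := by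
    refine PInt.sum hp _ _ fun l _ => PInt.WS hp _ _ _ (by omega) (by omega) fun x _ hx => ?_
    refine PInt.sum hp _ _ fun b hb => ?_
    rw [Finset.mem_Icc] at hb
    have hb' : ¬ ((p : ℤ) ∣ (b : ℤ)) := fun hh => by
      have := Nat.le_of_dvd (by omega) (Int.natCast_dvd_natCast.1 hh)
      omega
    have := PInt.inv (p := p) ((b : ℤ) ^ n * ((b : ℤ) - p)) (fun hh => by
      rcases (Nat.prime_iff_prime_int.1 hp).dvd_or_dvd hh with h | h
      · exact hb' ((Nat.prime_iff_prime_int.1 hp).dvd_of_dvd_pow h)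
      · exact hb' ((dvd_sub_self_right).1 h))
    simpa using this
  obtain ⟨a, b, hb, hab⟩ := hR
  refine ⟨a, b, hb, ?_⟩
  have hs : ∑ k' ∈ cycOrbit k, ∑ l ∈ Finset.range n, (p : ℚ) ^ l *
          Hstar (p - 1) (k'.tail ++ [k'.headI, l + 1]) =
      ∑ k' ∈ cycOrbit k, TT (p - 1) (k'.tail ++ [k'.headI]) + (- (p : ℚ) ^ n) *
        ∑ k' ∈ cycOrbit k, WS (k'.tail ++ [k'.headI])
      (fun m => ∑ b ∈ Finset.Icc 1 m, 1 / ((b : ℚ) ^ n * ((b : ℚ) - p))) (p - 1) := by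
    rw [Finset.mul_sum, ← Finset.sum_add_distrib]
    refine Finset.sum_congr rfl fun l _ => ?_
    rw [← tail_sum n p hp]
    simp
  rw [hs, orbit_identity (p - 1) k hk hne, ← hab]
  ring
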